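/- arXiv:1501.03976 — 3 statements merged into one kernel-verified Lean document; each statement's English description precedes it below -/
import Mathlib

section
/- Let θ ∈ (0, π/2), A = (0,0), B = (1,0), and let E > 0. Then there exist L > 0 and a smooth unit-speed curve γ : [0,L] → ℝ² whose curvature κ(s) := det(γ'(s), γ''(s)) satisfies −2κ'' = κ³ on [0,L], with γ(0) = A, γ(L) = B, γ'(0) = (cos θ, sin θ), γ'(L) = (cos θ, −sin θ), such that γ is axially symmetric (there exist P ∈ O(2) with det P = −1 and c ∈ ℝ² with γ(L−s) + Pγ(s) = c for all s ∈ [0,L]) and (1/2)∫₀ᴸ κ(s)² ds > E. In particular the Dirichlet problem with these boundary data has infinitely many axially symmetric solutions whose Willmore energies tend to +∞. -/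
/-- The signed curvature of a planar curve `γ`, given by
`κ(s) = det(γ'(s), γ''(s))`. -/
noncomputable def signedCurvature (γ : ℝ → EuclideanSpace ℝ (Fin 2)) (s : ℝ) : ℝ :=
  deriv γ s 0 * deriv (deriv γ) s 1 - deriv γ s 1 * deriv (deriv γ) s 0

open Real Set Filter MeasureTheory intervalIntegral
open scoped ContDiff

/-- A global solution `ψ` of `ψ' = √((1 + cos² ψ) / 2)`, `ψ 0 = 0`: the angle variable in which
the rectangular elastica `κ = √2 cos ψ` has no turning points. -/
theorem exists_elastica_angle :
    ∃ ψ : ℝ → ℝ, ContDiff ℝ ∞ ψ ∧ (∀ s, HasDerivAt ψ (√((1 + cos (ψ s) ^ 2) / 2)) s) ∧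
      (∀ s, ψ (-s) = -ψ s) ∧ Function.Surjective ψ := by
  set w : ℝ → ℝ := fun u ↦ (√((1 + cos u ^ 2) / 2))⁻¹ with hw
  have hpos : ∀ u, 0 < (1 + cos u ^ 2) / 2 := fun u ↦ by positivity
  have hw_pos : ∀ u, 0 < w u := fun u ↦ inv_pos.2 (sqrt_pos.2 (hpos u))
  have hw_one : ∀ u, 1 ≤ w u := fun u ↦ by
    refine one_le_inv_iff₀.2 ⟨sqrt_pos.2 (hpos u), sqrt_le_one.2 ?_⟩
    linarith [cos_sq_le_one u]
  have hw_smooth : ContDiff ℝ ∞ w := by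
    refine ContDiff.inv (ContDiff.sqrt ?_ fun u ↦ (hpos u).ne') fun u ↦ (sqrt_pos.2 (hpos u)).ne'
    exact (contDiff_const.add (contDiff_cos.pow 2)).div_const 2
  set F : ℝ → ℝ := fun v ↦ ∫ u in (0 : ℝ)..v, w u with hF
  have hFd : ∀ v, HasDerivAt F (w v) v := fun v ↦
    hw_smooth.continuous.integral_hasStrictDerivAt 0 v |>.hasDerivAt
  have hF_odd : ∀ v, F (-v) = -F v := fun v ↦ by
    have h := integral_comp_neg (f := w) (a := 0) (b := v)
    simp only [neg_zero] at h
    rw [hF]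
    simp only
    rw [integral_symm, ← h]
    simp [hw]
  have hF_cont : Continuous F := continuous_iff_continuousAt.2 fun v ↦ (hFd v).continuousAt
  have hF_mono : StrictMono F := strictMono_of_deriv_pos fun v ↦ by
    rw [(hFd v).deriv]; exact hw_pos v
  have hF_ge : ∀ v, 0 ≤ v → v ≤ F v := fun v hv ↦ by
    have h := integral_mono_on hv (f := fun _ ↦ (1 : ℝ)) (g := w)
      (continuous_const.intervalIntegrable (μ := volume) _ _)
      (hw_smooth.continuous.intervalIntegrable _ _) fun u _ ↦ hw_one u
    simpa using h
  have hF_top : Tendsto F atTop atTop :=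
    tendsto_atTop_mono' _ ((eventually_ge_atTop 0).mono hF_ge) tendsto_id
  have hF_bot : Tendsto F atBot atBot := by
    have h : F = fun v ↦ -F (-v) := funext fun v ↦ by rw [hF_odd, neg_neg]
    rw [h]
    exact tendsto_neg_atTop_atBot.comp (hF_top.comp tendsto_neg_atBot_atTop)
  set e : ℝ ≃ₜ ℝ :=
    (hF_mono.orderIsoOfSurjective F (hF_cont.surjective hF_top hF_bot)).toHomeomorph with he
  have heF : ∀ v, e v = F v := fun v ↦ rfl
  have hF_smooth : ContDiff ℝ ∞ F := by
    refine contDiff_infty_iff_deriv.2 ⟨fun v ↦ (hFd v).differentiableAt, ?_⟩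
    rwa [show deriv F = w from funext fun v ↦ (hFd v).deriv]
  refine ⟨e.symm, e.contDiff_symm_deriv (fun v ↦ (hw_pos v).ne') hFd hF_smooth, fun s ↦ ?_,
    fun s ↦ ?_, e.symm.surjective⟩
  · have h := HasDerivAt.of_local_left_inverse e.symm.continuous.continuousAt (hFd (e.symm s))
      (hw_pos _).ne' (Eventually.of_forall fun y ↦ e.apply_symm_apply y)
    simpa [hw] using h
  · apply e.injective
    rw [e.apply_symm_apply, heF, hF_odd, ← heF, e.apply_symm_apply]

/-- The rectangular elastica `s ↦ (X s, -f s)` has unit speed, curvature `f`, is symmetric about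
`s = 0`, and has tangent `(cos θ, -sin θ)` at points with arbitrarily large abscissa. -/
theorem exists_rectangular_elastica :
    ∃ f f' X : ℝ → ℝ, ContDiff ℝ ∞ f ∧ ContDiff ℝ ∞ X ∧
      (∀ s, HasDerivAt f (f' s) s) ∧ (∀ s, HasDerivAt f' (-(f s ^ 3 / 2)) s) ∧
      (∀ s, HasDerivAt X (f s ^ 2 / 2) s) ∧ (∀ s, f' s ^ 2 + f s ^ 4 / 4 = 1) ∧
      (∀ s, f (-s) = f s) ∧ (∀ s, f' (-s) = -f' s) ∧ (∀ s, X (-s) = -X s) ∧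
      ∀ θ ∈ Ioo 0 (π / 2), ∀ M, ∃ a, 0 < a ∧ M < X a ∧ f a ^ 2 / 2 = cos θ ∧ f' a = sin θ := by
  obtain ⟨ψ, hψ, hψd, hψ_odd, hψ_surj⟩ := exists_elastica_angle
  have h2 : √2 ^ 2 = (2 : ℝ) := sq_sqrt (by norm_num)
  have h2pos : 0 < √2 := by positivity
  set r : ℝ → ℝ := fun s ↦ √(1 + cos (ψ s) ^ 2) with hr
  have hr_pos : ∀ s, 0 < r s := fun s ↦ sqrt_pos.2 (by positivity)
  have hr_sq : ∀ s, r s ^ 2 = 1 + cos (ψ s) ^ 2 := fun s ↦ sq_sqrt (by positivity)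
  have hψr : ∀ s, HasDerivAt ψ (r s / √2) s := fun s ↦ by
    have h := hψd s
    rwa [sqrt_div (by positivity)] at h
  have hψ0 : ψ 0 = 0 := by
    have h := hψ_odd 0
    rw [neg_zero] at h
    linarith
  have hψ_mono : StrictMono ψ := strictMono_of_deriv_pos fun s ↦ by
    rw [(hψr s).deriv]; exact div_pos (hr_pos s) h2pos
  set X : ℝ → ℝ := fun v ↦ ∫ s in (0 : ℝ)..v, cos (ψ s) ^ 2 with hX
  have hc : ContDiff ℝ ∞ fun s ↦ cos (ψ s) := contDiff_cos.comp hψ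
  have hXd : ∀ v, HasDerivAt X (cos (ψ v) ^ 2) v := fun v ↦
    (hc.pow 2).continuous.integral_hasStrictDerivAt 0 v |>.hasDerivAt
  have hf : ∀ s, (√2 * cos (ψ s)) ^ 2 / 2 = cos (ψ s) ^ 2 := fun s ↦ by
    rw [mul_pow, h2]; ring
  refine ⟨fun s ↦ √2 * cos (ψ s), fun s ↦ -sin (ψ s) * r s, X, contDiff_const.mul hc, ?_,
    fun s ↦ ?_, fun s ↦ ?_, fun s ↦ ?_, fun s ↦ ?_, fun s ↦ ?_, fun s ↦ ?_, fun s ↦ ?_, ?_⟩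
  · refine contDiff_infty_iff_deriv.2 ⟨fun v ↦ (hXd v).differentiableAt, ?_⟩
    rw [show deriv X = fun v ↦ cos (ψ v) ^ 2 from funext fun v ↦ (hXd v).deriv]
    exact hc.pow 2
  · refine HasDerivAt.congr_deriv ((hψr s).cos.const_mul √2) ?_
    field_simp
  · have hrd := (((hψr s).cos.fun_pow 2).const_add 1).sqrt
      (ne_of_gt (by positivity : (0 : ℝ) < 1 + cos (ψ s) ^ 2))
    refine HasDerivAt.congr_deriv ((hψr s).sin.fun_neg.mul hrd) ?_
    have hs := sin_sq_add_cos_sq (ψ s)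
    have h3 : √2 ^ 3 = 2 * √2 := by rw [pow_succ, h2]
    have hr1 := hr_sq s
    have hr0 := (hr_pos s).ne'
    simp only [hr] at hr1 hr0 ⊢
    generalize √(1 + cos (ψ s) ^ 2) = R at *
    generalize cos (ψ s) = c at *
    generalize sin (ψ s) = t at *
    rw [mul_pow, h3]
    field_simp
    have ht : t ^ 2 = 1 - c ^ 2 := by linarith
    simp only [h2, ht, hr1]
    ring
  · simpa only [hf] using hXd s
  · have hs := sin_sq_add_cos_sq (ψ s)
    have h4 : √2 ^ 4 = 4 := by rw [show 4 = 2 * 2 from rfl, pow_mul, h2]; norm_num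
    have hs' : sin (ψ s) ^ 2 = 1 - cos (ψ s) ^ 2 := by linarith
    simp only [mul_pow, neg_sq, hr_sq, h4, hs']
    ring
  · simp [hψ_odd]
  · simp [hψ_odd, hr]
  · have h := integral_comp_neg (f := fun s ↦ cos (ψ s) ^ 2) (a := 0) (b := s)
    simp only [neg_zero, hψ_odd, cos_neg] at h
    simp only [hX]
    rw [integral_symm, ← h]
  · have hX_ge : ∀ s, 0 ≤ s → ψ s / 2 - 1 / 4 ≤ X s := by
      intro s hs
      have hd : ∀ s, HasDerivAt (fun s ↦ X s - (ψ s / 2 + sin (2 * ψ s) / 4))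
          (cos (ψ s) ^ 2 * (1 - r s / √2)) s := fun s ↦ by
        refine HasDerivAt.congr_deriv ((hXd s).sub (((hψr s).div_const 2).add
          (((hψr s).const_mul 2).sin.div_const 4))) ?_
        rw [cos_two_mul]
        ring
      have hmono : Monotone fun s ↦ X s - (ψ s / 2 + sin (2 * ψ s) / 4) :=
        monotone_of_hasDerivAt_nonneg hd fun s ↦ by
          refine mul_nonneg (sq_nonneg _) (sub_nonneg.2 ((div_le_one h2pos).2 ?_))
          exact sqrt_le_sqrt (by linarith [cos_sq_le_one (ψ s)])
      have h := hmono hs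
      simp only [hψ0, hX, integral_same] at h
      simp only [mul_zero, sin_zero, zero_div, add_zero, sub_zero] at h
      linarith [neg_one_le_sin (2 * ψ s)]
    intro θ hθ M
    have hcos : 0 < cos θ := cos_pos_of_mem_Ioo ⟨by linarith [hθ.1, pi_pos], hθ.2⟩
    have hsin : 0 < sin θ := sin_pos_of_pos_of_lt_pi hθ.1 (by linarith [hθ.2, pi_pos])
    set u := arccos √(cos θ) with hu
    have hcu : cos u = √(cos θ) :=
      cos_arccos (by linarith [sqrt_nonneg (cos θ)]) (sqrt_le_one.2 (cos_le_one θ))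
    have hcu2 : cos u ^ 2 = cos θ := by rw [hcu, sq_sqrt hcos.le]
    obtain ⟨n, hn⟩ := exists_nat_gt ((2 * |M| + 1 + u) / (2 * π))
    have hn' : 2 * |M| + 1 + u < n * (2 * π) := (div_lt_iff₀ (by positivity)).1 hn
    obtain ⟨a, ha⟩ := hψ_surj (n * (2 * π) - u)
    have ha_pos : 0 < a := by
      rw [← hψ_mono.lt_iff_lt, hψ0, ha]
      linarith [abs_nonneg M]
    have hca : cos (ψ a) = cos u := by rw [ha, cos_nat_mul_two_pi_sub]
    have hsa : sin (ψ a) = -sin u := by rw [ha, sin_nat_mul_two_pi_sub]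
    refine ⟨a, ha_pos, ?_, ?_, ?_⟩
    · have h := hX_ge a ha_pos.le
      rw [ha] at h
      linarith [le_abs_self M]
    · rw [hf, hca, hcu2]
    · have hsu : 0 ≤ sin u := sin_nonneg_of_nonneg_of_le_pi (arccos_nonneg _) (arccos_le_pi _)
      refine (sq_eq_sq₀ ?_ hsin.le).1 ?_
      · simp only [hsa, neg_neg]
        exact mul_nonneg hsu (hr_pos a).le
      · have h1 := sin_sq_add_cos_sq u
        have h3 := sin_sq_add_cos_sq θ
        simp only [mul_pow, neg_sq, hr_sq, hca, hsa, hcu2]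
        rw [hcu2] at h1
        rw [show sin u ^ 2 = 1 - cos θ by linarith]
        linarith

theorem hasDerivAt_plane {f g : ℝ → ℝ} {f' g' s : ℝ} (hf : HasDerivAt f f' s)
    (hg : HasDerivAt g g' s) :
    HasDerivAt (fun t ↦ !₂[f t, g t] : ℝ → EuclideanSpace ℝ (Fin 2)) !₂[f', g'] s := by
  have h : HasDerivAt (fun t ↦ ![f t, g t]) ![f', g'] s :=
    hasDerivAt_pi.2 fun i ↦ by fin_cases i <;> simpa
  exact (PiLp.continuousLinearEquiv 2 ℝ fun _ : Fin 2 ↦ ℝ).symm.hasFDerivAt.comp_hasDerivAt s h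

theorem exists_reflection_plane :
    ∃ P : EuclideanSpace ℝ (Fin 2) ≃ₗᵢ[ℝ] EuclideanSpace ℝ (Fin 2),
      LinearMap.det (P.toLinearEquiv :
        EuclideanSpace ℝ (Fin 2) →ₗ[ℝ] EuclideanSpace ℝ (Fin 2)) = -1 ∧
      ∀ x y : ℝ, P !₂[x, y] = !₂[x, -y] := by
  set P : EuclideanSpace ℝ (Fin 2) ≃ₗᵢ[ℝ] EuclideanSpace ℝ (Fin 2) :=
    LinearIsometryEquiv.piLpCongrRight 2
      ![LinearIsometryEquiv.refl ℝ ℝ, LinearIsometryEquiv.neg ℝ] with hP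
  have hPxy : ∀ x y : ℝ, P !₂[x, y] = !₂[x, -y] := fun x y ↦ by
    ext i
    fin_cases i <;> simp [hP]
  refine ⟨P, ?_, hPxy⟩
  rw [← LinearMap.det_toMatrix (EuclideanSpace.basisFun (Fin 2) ℝ).toBasis, Matrix.det_fin_two]
  simp [LinearMap.toMatrix_apply, hP]

/-- For `θ ∈ (0,π/2)`, `A = (0,0)`, `B = (1,0)` and any `E > 0`, the Dirichlet problem
with boundary directions `(cos θ, sin θ)` and `(cos θ, −sin θ)` admits an axially
symmetric Willmore curve solution whose Willmore energy exceeds `E`; in particular it has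
infinitely many axially symmetric solutions with energies tending to `+∞`. -/
theorem dirichlet_problem_axially_symmetric_solutions
    (θ : ℝ) (hθ : θ ∈ Set.Ioo 0 (Real.pi / 2)) (E : ℝ) (hE : 0 < E) :
    ∃ (L : ℝ) (γ : ℝ → EuclideanSpace ℝ (Fin 2)),
      0 < L ∧ ContDiff ℝ (⊤ : ℕ∞) γ ∧
      (∀ s ∈ Set.Icc (0 : ℝ) L, ‖deriv γ s‖ = 1) ∧
      (∀ s ∈ Set.Icc (0 : ℝ) L,
        -(2 * deriv (deriv (signedCurvature γ)) s) = (signedCurvature γ s) ^ 3) ∧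
      (γ 0 0 = 0 ∧ γ 0 1 = 0) ∧ (γ L 0 = 1 ∧ γ L 1 = 0) ∧
      (deriv γ 0 0 = Real.cos θ ∧ deriv γ 0 1 = Real.sin θ) ∧
      (deriv γ L 0 = Real.cos θ ∧ deriv γ L 1 = -Real.sin θ) ∧
      (∃ (P : EuclideanSpace ℝ (Fin 2) ≃ₗᵢ[ℝ] EuclideanSpace ℝ (Fin 2))
         (c : EuclideanSpace ℝ (Fin 2)),
          LinearMap.det (P.toLinearEquiv :
            EuclideanSpace ℝ (Fin 2) →ₗ[ℝ] EuclideanSpace ℝ (Fin 2)) = -1 ∧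
          ∀ s ∈ Set.Icc (0 : ℝ) L, γ (L - s) + P (γ s) = c) ∧
      (1 / 2) * (∫ s in (0 : ℝ)..L, (signedCurvature γ s) ^ 2) > E := by
  obtain ⟨f, f', X, hf, hX, hfd, hf'd, hXd, hunit, hf_even, hf'_odd, hX_odd, hlarge⟩ :=
    exists_rectangular_elastica
  obtain ⟨a, ha, haX, hcos, hsin⟩ := hlarge θ hθ (1 + E)
  obtain ⟨P, hPdet, hP⟩ := exists_reflection_plane
  set D : ℝ := 2 * X a with hD
  have hD1 : 1 + E < D := by linarith
  have hDpos : 0 < D := by linarith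
  have hD0 : D ≠ 0 := hDpos.ne'
  have hlin : ∀ s : ℝ, HasDerivAt (fun s ↦ D * s - a) D s := fun s ↦ by
    simpa using ((hasDerivAt_id s).const_mul D).sub_const a
  have hscale : ∀ {g : ℝ → ℝ} {g' : ℝ} (s : ℝ), HasDerivAt g g' (D * s - a) →
      HasDerivAt (fun s ↦ g (D * s - a)) (g' * D) s := fun s h ↦ h.comp s (hlin s)
  set γ : ℝ → EuclideanSpace ℝ (Fin 2) :=
    fun s ↦ !₂[(X (D * s - a) + X a) / D, (f a - f (D * s - a)) / D] with hγ
  have hγd : deriv γ = fun s ↦ !₂[f (D * s - a) ^ 2 / 2, -f' (D * s - a)] := funext fun s ↦ by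
    refine HasDerivAt.deriv (hasDerivAt_plane ?_ ?_)
    · refine HasDerivAt.congr_deriv (((hscale s (hXd _)).add_const (X a)).div_const D) ?_
      field_simp
    · refine HasDerivAt.congr_deriv (((hscale s (hfd _)).const_sub (f a)).div_const D) ?_
      field_simp
  have hγdd : deriv (deriv γ) = fun s ↦
      !₂[D * (f (D * s - a) * f' (D * s - a)), D * (f (D * s - a) ^ 3 / 2)] := funext fun s ↦ by
    rw [hγd]
    refine HasDerivAt.deriv (hasDerivAt_plane ?_ ?_)
    · refine HasDerivAt.congr_deriv (((hscale s (hfd _)).pow 2).div_const 2) ?_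
      push_cast
      ring
    · refine HasDerivAt.congr_deriv ((hscale s (hf'd _)).neg) ?_
      ring
  have hκ : signedCurvature γ = fun s ↦ D * f (D * s - a) := funext fun s ↦ by
    rw [signedCurvature, hγdd, hγd]
    simp only [Matrix.cons_val_zero, Matrix.cons_val_one]
    linear_combination D * f (D * s - a) * hunit (D * s - a)
  have hend : D * (2 * a / D) - a = a := by
    rw [mul_div_cancel₀ _ hD0]; ring
  have hstart : D * 0 - a = -a := by ring
  refine ⟨2 * a / D, γ, by positivity, ?_, fun s _ ↦ ?_, fun s _ ↦ ?_, ?_, ?_, ?_, ?_,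
    ⟨P, !₂[1, 0], hPdet, fun s _ ↦ ?_⟩, ?_⟩
  · have hl : ContDiff ℝ ∞ fun s : ℝ ↦ D * s - a := by fun_prop
    refine contDiff_euclidean.2 fun i ↦ ?_
    fin_cases i
    · exact ((hX.comp hl).add contDiff_const).div_const D
    · exact (contDiff_const.sub (hf.comp hl)).div_const D
  · rw [hγd, EuclideanSpace.norm_eq, sqrt_eq_one]
    simp only [Fin.sum_univ_two, Matrix.cons_val_zero, Matrix.cons_val_one,
      norm_eq_abs, sq_abs]
    linear_combination hunit (D * s - a)
  · have hκd : deriv (signedCurvature γ) = fun s ↦ D * (f' (D * s - a) * D) := funext fun s ↦ by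
      rw [hκ]
      exact ((hscale s (hfd _)).const_mul D).deriv
    rw [hκd, ((((hscale s (hf'd _)).mul_const D).const_mul D).deriv), hκ]
    ring
  · simp [hγ, hX_odd, hf_even]
  · simp only [hγ, hend, Matrix.cons_val_zero, Matrix.cons_val_one]
    refine ⟨?_, by simp⟩
    rw [← two_mul, ← hD, div_self hD0]
  · rw [hγd]
    simp only [hstart, hf_even, hf'_odd, Matrix.cons_val_zero,
      Matrix.cons_val_one]
    exact ⟨hcos, by rw [neg_neg, hsin]⟩
  · rw [hγd]
    simp only [hend, Matrix.cons_val_zero, Matrix.cons_val_one]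
    exact ⟨hcos, by rw [hsin]⟩
  · have hrev : D * (2 * a / D - s) - a = -(D * s - a) := by
      rw [mul_sub, mul_div_cancel₀ _ hD0]; ring
    simp only [hγ, hP, hrev, hX_odd, hf_even]
    ext i
    fin_cases i
    · simp only [Fin.zero_eta, PiLp.add_apply, Matrix.cons_val_zero]
      rw [← add_div, div_eq_one_iff_eq hD0]
      ring
    · simp
  · have hint := integral_eq_sub_of_hasDerivAt (a := 0) (b := 2 * a / D)
      (fun s _ ↦ (hscale s (hXd _)).const_mul (2 * D))
      (Continuous.intervalIntegrable (by have := hf.continuous; fun_prop) _ _)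
    have heq : ∀ s, signedCurvature γ s ^ 2 = 2 * D * (f (D * s - a) ^ 2 / 2 * D) := fun s ↦ by
      rw [hκ]; ring
    simp only [heq]
    rw [hint, hend, hstart, hX_odd]
    nlinarith
end

section
/- Let θ ∈ (0, π/2), A = (0,0), B = (1,0), and let E > 0. Then there exist L > 0 and a smooth unit-speed curve γ : [0,L] → ℝ² whose curvature κ(s) := det(γ'(s), γ''(s)) satisfies −2κ'' = κ³ on [0,L], with γ(0) = A, γ(L) = B, γ'(0) = (cos θ, sin θ), γ'(L) = (cos θ, −sin θ), such that γ is NOT axially symmetric (there exist no P ∈ O(2) with det P = −1 and c ∈ ℝ² with γ(L−s) + Pγ(s) = c for all s ∈ [0,L]) and (1/2)∫₀ᴸ κ(s)² ds > E. In particular the Dirichlet problem with these symmetric boundary data has infinitely many axially non-symmetric solutions whose Willmore energies tend to +∞. -/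
namespace WillmoreCurve

open Real Set Filter Topology

/-- The angular speed of the lemniscatic amplitude. -/
noncomputable def angularSpeed (p : ℝ) : ℝ := √(1 + sin p ^ 2)

lemma angularSpeed_sq (p : ℝ) : angularSpeed p ^ 2 = 1 + sin p ^ 2 :=
  Real.sq_sqrt (by positivity)

lemma angularSpeed_pos (p : ℝ) : 0 < angularSpeed p := Real.sqrt_pos.2 (by positivity)

lemma angularSpeed_le_two (p : ℝ) : angularSpeed p ≤ 2 := by
  nlinarith [angularSpeed_sq p, angularSpeed_pos p, sin_sq_le_one p]

lemma contDiff_angularSpeed : ContDiff ℝ (⊤ : ℕ∞) angularSpeed :=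
  (contDiff_const.add (contDiff_sin.pow 2)).sqrt fun p => by positivity

lemma exists_hasDerivAt_of_continuous {f : ℝ → ℝ} (hf : Continuous f) :
    ∃ F : ℝ → ℝ, ∀ x, HasDerivAt F (f x) x :=
  ⟨fun x => ∫ t in (0 : ℝ)..x, f t, fun _ =>
    intervalIntegral.integral_hasDerivAt_right (hf.intervalIntegrable _ _)
      hf.stronglyMeasurable.stronglyMeasurableAtFilter hf.continuousAt⟩

lemma contDiff_of_hasDerivAt_comp {p f : ℝ → ℝ} (hf : ContDiff ℝ (⊤ : ℕ∞) f)
    (hp : ∀ s, HasDerivAt p (f (p s)) s) : ContDiff ℝ (⊤ : ℕ∞) p := by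
  have hd : Differentiable ℝ p := fun s => (hp s).differentiableAt
  have hderiv : deriv p = f ∘ p := funext fun s => (hp s).deriv
  refine contDiff_infty.2 fun n => ?_
  induction n with
  | zero => exact contDiff_zero.2 hd.continuous
  | succ n ih =>
    push_cast
    refine contDiff_succ_iff_deriv.2 ⟨hd, by simp, ?_⟩
    rw [hderiv]
    exact (contDiff_infty.1 hf n).comp ih

lemma exists_amplitude : ∃ p : ℝ → ℝ,
    (∀ s, HasDerivAt p (angularSpeed (p s)) s) ∧ Function.Surjective p := by
  obtain ⟨F, hF⟩ := exists_hasDerivAt_of_continuous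
    (f := fun p => (angularSpeed p)⁻¹)
    (contDiff_angularSpeed.continuous.inv₀ fun p => (angularSpeed_pos p).ne')
  have hmono : StrictMono F := strictMono_of_deriv_pos fun x => by
    rw [(hF x).deriv]; exact inv_pos.2 (angularSpeed_pos x)
  have hcont : Continuous F := continuous_iff_continuousAt.2 fun x => (hF x).continuousAt
  have hlin : Monotone fun x => F x - x / 2 := by
    have hd : ∀ x, HasDerivAt (fun x => F x - x / 2) ((angularSpeed x)⁻¹ - 1 / 2) x :=
      fun x => (hF x).sub ((hasDerivAt_id x).div_const 2)
    refine monotone_of_deriv_nonneg (fun x => (hd x).differentiableAt) fun x => ?_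
    rw [(hd x).deriv, sub_nonneg, one_div]
    exact inv_anti₀ (angularSpeed_pos x) (angularSpeed_le_two x)
  have htop : Tendsto F atTop atTop := by
    refine tendsto_atTop_mono' atTop (f₁ := fun x => F 0 + x / 2) ?_
      (tendsto_atTop_add_const_left _ _ (tendsto_id.atTop_div_const two_pos))
    filter_upwards [eventually_ge_atTop 0] with x hx
    have := hlin hx
    simp only at this
    linarith
  have hbot : Tendsto F atBot atBot := by
    refine tendsto_atBot_mono' atBot (f₁ := fun x => F 0 + x / 2) ?_
      (tendsto_atBot_add_const_left _ _ (tendsto_id.atBot_div_const two_pos))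
    filter_upwards [eventually_le_atBot 0] with x hx
    have := hlin hx
    simp only at this
    linarith
  let e := hmono.orderIsoOfSurjective F (hcont.surjective htop hbot)
  refine ⟨e.symm, fun s => ?_, e.symm.surjective⟩
  have h := (hF (e.symm s)).of_local_left_inverse (f := F) (g := e.symm)
    e.symm.continuous.continuousAt
    (inv_ne_zero (angularSpeed_pos _).ne') (Eventually.of_forall fun y => e.apply_symm_apply y)
  rwa [inv_inv] at h

lemma det_isometry_apply
    (P : EuclideanSpace ℝ (Fin 2) ≃ₗᵢ[ℝ] EuclideanSpace ℝ (Fin 2))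
    (hP : LinearMap.det (P.toLinearEquiv :
      EuclideanSpace ℝ (Fin 2) →ₗ[ℝ] EuclideanSpace ℝ (Fin 2)) = -1)
    (u v : EuclideanSpace ℝ (Fin 2)) :
    P u 0 * P v 1 - P u 1 * P v 0 = -(u 0 * v 1 - u 1 * v 0) := by
  have h := (EuclideanSpace.basisFun (Fin 2) ℝ).toBasis.det_comp
    (P.toLinearEquiv : EuclideanSpace ℝ (Fin 2) →ₗ[ℝ] EuclideanSpace ℝ (Fin 2)) ![u, v]
  rw [hP] at h
  simp [Module.Basis.det_apply, Matrix.det_fin_two, Module.Basis.toMatrix_apply] at h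
  linarith

lemma signedCurvature_endpoints_eq_of_axiallySymmetric
    {γ : ℝ → EuclideanSpace ℝ (Fin 2)} (hγ : ContDiff ℝ (⊤ : ℕ∞) γ) {L : ℝ} (hL : 0 < L)
    (P : EuclideanSpace ℝ (Fin 2) ≃ₗᵢ[ℝ] EuclideanSpace ℝ (Fin 2))
    (c : EuclideanSpace ℝ (Fin 2))
    (hP : LinearMap.det (P.toLinearEquiv :
      EuclideanSpace ℝ (Fin 2) →ₗ[ℝ] EuclideanSpace ℝ (Fin 2)) = -1)
    (hsymm : ∀ s ∈ Icc (0 : ℝ) L, γ (L - s) + P (γ s) = c) :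
    signedCurvature γ L = signedCurvature γ 0 := by
  have hγ' : ContDiff ℝ (⊤ : ℕ∞) (deriv γ) := (contDiff_infty_iff_deriv.1 hγ).2
  have hγ'' : ContDiff ℝ (⊤ : ℕ∞) (deriv (deriv γ)) := (contDiff_infty_iff_deriv.1 hγ').2
  have hdiff : ∀ {f : ℝ → EuclideanSpace ℝ (Fin 2)}, ContDiff ℝ (⊤ : ℕ∞) f →
      ∀ s, HasDerivAt f (deriv f s) s := fun hf s =>
    ((contDiff_infty_iff_deriv.1 hf).1 s).hasDerivAt
  have hrefl : ∀ {f : ℝ → EuclideanSpace ℝ (Fin 2)}, ContDiff ℝ (⊤ : ℕ∞) f →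
      ∀ s, HasDerivAt (fun t => f (L - t)) (-deriv f (L - s)) s := fun hf s => by
    simpa [Function.comp_def] using
      (hdiff hf (L - s)).scomp s ((hasDerivAt_id s).const_sub L)
  have hPd : ∀ {f : ℝ → EuclideanSpace ℝ (Fin 2)}, ContDiff ℝ (⊤ : ℕ∞) f →
      ∀ s, HasDerivAt (fun t => P (f t)) (P (deriv f s)) s := fun hf s =>
    P.toContinuousLinearEquiv.toContinuousLinearMap.hasFDerivAt.comp_hasDerivAt s (hdiff hf s)
  have h1 : ∀ s ∈ Ioo 0 L, deriv γ (L - s) = P (deriv γ s) := fun s hs => by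
    have hd := ((hrefl hγ s).add (hPd hγ s)).unique
      ((hasDerivAt_const s c).congr_of_eventuallyEq (by
        filter_upwards [Ioo_mem_nhds hs.1 hs.2] with t ht
        exact hsymm t (Ioo_subset_Icc_self ht)))
    rwa [neg_add_eq_zero] at hd
  have h2 : ∀ s ∈ Ioo 0 L, deriv (deriv γ) (L - s) = -P (deriv (deriv γ) s) := fun s hs => by
    have hd := (hrefl hγ' s).unique
      ((hPd hγ' s).congr_of_eventuallyEq (by
        filter_upwards [Ioo_mem_nhds hs.1 hs.2] with t ht
        exact h1 t ht))
    rw [← hd, neg_neg]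
  have hκ : Continuous (signedCurvature γ) := by
    have := hγ'.continuous
    have := hγ''.continuous
    unfold signedCurvature
    fun_prop
  have heq : EqOn (fun s => signedCurvature γ (L - s)) (signedCurvature γ) (Ioo 0 L) := by
    intro s hs
    have := det_isometry_apply P hP (deriv γ s) (deriv (deriv γ) s)
    simp only [signedCurvature, h1 s hs, h2 s hs, PiLp.neg_apply]
    linarith
  have hcl := heq.closure (by fun_prop) hκ
  rw [closure_Ioo hL.ne] at hcl
  simpa using hcl (left_mem_Icc.2 hL.le)

/-- The rescaled and rotated rectangular elastica with amplitude `p` and horizontal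
coordinate `X`, starting at the parameter `a`. -/
noncomputable def elastica (p X : ℝ → ℝ) (D δ a s : ℝ) : EuclideanSpace ℝ (Fin 2) :=
  !₂[(cos δ * (X (D * s + a) - X a) - sin δ * (sin (p (D * s + a)) - sin (p a))) / D,
    (-(sin δ * (X (D * s + a) - X a)) - cos δ * (sin (p (D * s + a)) - sin (p a))) / D]

section elastica

variable {p X : ℝ → ℝ} {D : ℝ} (δ a : ℝ)

lemma hasDerivAt_comp_affine {f f' : ℝ → ℝ} (hf : ∀ s, HasDerivAt f (f' s) s) (s : ℝ) :
    HasDerivAt (fun s => f (D * s + a)) (D * f' (D * s + a)) s := by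
  have h := (hf (D * s + a)).comp s (((hasDerivAt_id s).const_mul D).add_const a)
  rw [mul_one, mul_comm] at h
  exact h

lemma hasDerivAt_vec {f g : ℝ → ℝ} {f' g' s : ℝ} (hf : HasDerivAt f f' s)
    (hg : HasDerivAt g g' s) :
    HasDerivAt (fun s => (!₂[f s, g s] : EuclideanSpace ℝ (Fin 2))) !₂[f', g'] s := by
  have h : HasDerivAt (fun s => ![f s, g s]) ![f', g'] s :=
    hasDerivAt_pi.2 fun i => by
      fin_cases i
      · exact hf
      · exact hg
  exact (PiLp.hasFDerivAt_toLp (𝕜 := ℝ) 2 _).comp_hasDerivAt s h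

lemma deriv_elastica (hp : ∀ s, HasDerivAt p (angularSpeed (p s)) s)
    (hX : ∀ s, HasDerivAt X (sin (p s) ^ 2) s) (hD : D ≠ 0) :
    deriv (elastica p X D δ a) = fun s =>
      !₂[cos δ * sin (p (D * s + a)) ^ 2
          - sin δ * (cos (p (D * s + a)) * angularSpeed (p (D * s + a))),
        -(sin δ * sin (p (D * s + a)) ^ 2)
          - cos δ * (cos (p (D * s + a)) * angularSpeed (p (D * s + a)))] := by
  funext s
  have h1 := (hasDerivAt_comp_affine (D := D) a hX s).sub_const (X a)
  have h2 := (hasDerivAt_comp_affine (D := D) a (fun s => (hp s).sin) s).sub_const (sin (p a))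
  have h := hasDerivAt_vec
    (((h1.const_mul (cos δ)).sub (h2.const_mul (sin δ))).div_const D)
    (((h1.const_mul (sin δ)).neg.sub (h2.const_mul (cos δ))).div_const D)
  refine HasDerivAt.deriv (h.congr_deriv ?_)
  congr 2
  · field_simp
  · congr 1
    field_simp

lemma sin_pow_four_add (q : ℝ) : sin q ^ 4 + (cos q * angularSpeed q) ^ 2 = 1 := by
  rw [mul_pow, angularSpeed_sq, cos_sq']
  ring

lemma hasDerivAt_cos_mul_angularSpeed (hp : ∀ s, HasDerivAt p (angularSpeed (p s)) s) (s : ℝ) :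
    HasDerivAt (fun s => cos (p s) * angularSpeed (p s)) (-2 * sin (p s) ^ 3) s := by
  have hs : HasDerivAt (fun s => angularSpeed (p s)) (sin (p s) * cos (p s)) s := by
    have h := ((((hp s).sin).fun_pow 2).const_add 1).sqrt (by positivity)
    refine h.congr_deriv ?_
    change _ / (2 * angularSpeed (p s)) = _
    have := (angularSpeed_pos (p s)).ne'
    field_simp
    ring
  refine ((hp s).cos.mul hs).congr_deriv ?_
  linear_combination (-sin (p s)) * angularSpeed_sq (p s) + sin (p s) * sin_sq_add_cos_sq (p s)

lemma signedCurvature_elastica (hp : ∀ s, HasDerivAt p (angularSpeed (p s)) s)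
    (hX : ∀ s, HasDerivAt X (sin (p s) ^ 2) s) (hD : D ≠ 0) :
    signedCurvature (elastica p X D δ a) = fun s => 2 * D * sin (p (D * s + a)) := by
  funext s
  have h1 := hasDerivAt_comp_affine (D := D) a (fun s => ((hp s).sin).pow 2) s
  have h2 := hasDerivAt_comp_affine (D := D) a (hasDerivAt_cos_mul_angularSpeed hp) s
  have h := hasDerivAt_vec
    ((h1.const_mul (cos δ)).sub (h2.const_mul (sin δ)))
    ((h1.const_mul (sin δ)).neg.sub (h2.const_mul (cos δ)))
  have h' := h.deriv
  unfold signedCurvature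
  rw [deriv_elastica δ a hp hX hD]
  simp only [Pi.sub_apply, Pi.neg_apply, Pi.pow_apply] at h'
  rw [h']
  simp
  have hT := sin_pow_four_add (p (D * s + a))
  linear_combination 2 * D * sin (p (D * s + a)) * (sin_sq_add_cos_sq δ + (sin δ ^ 2 + cos δ ^ 2) * hT)

lemma willmore_elastica (hp : ∀ s, HasDerivAt p (angularSpeed (p s)) s)
    (hX : ∀ s, HasDerivAt X (sin (p s) ^ 2) s) (hD : D ≠ 0) (s : ℝ) :
    -(2 * deriv (deriv (signedCurvature (elastica p X D δ a))) s)
      = signedCurvature (elastica p X D δ a) s ^ 3 := by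
  rw [signedCurvature_elastica δ a hp hX hD]
  have h1 : deriv (fun s => 2 * D * sin (p (D * s + a))) = fun s =>
      2 * D * (D * (cos (p (D * s + a)) * angularSpeed (p (D * s + a)))) := funext fun s =>
    ((hasDerivAt_comp_affine (D := D) a (fun s => (hp s).sin) s).const_mul (2 * D)).deriv
  have h2 := (((hasDerivAt_comp_affine (D := D) a (hasDerivAt_cos_mul_angularSpeed hp)
    s).const_mul D).const_mul (2 * D)).deriv
  rw [h1, h2]
  ring

lemma norm_deriv_elastica (hp : ∀ s, HasDerivAt p (angularSpeed (p s)) s)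
    (hX : ∀ s, HasDerivAt X (sin (p s) ^ 2) s) (hD : D ≠ 0) (s : ℝ) :
    ‖deriv (elastica p X D δ a) s‖ = 1 := by
  rw [deriv_elastica δ a hp hX hD, EuclideanSpace.norm_eq, Real.sqrt_eq_one]
  simp
  have hT := sin_pow_four_add (p (D * s + a))
  linear_combination sin_sq_add_cos_sq δ + (sin δ ^ 2 + cos δ ^ 2) * hT

lemma contDiff_elastica (hp : ContDiff ℝ (⊤ : ℕ∞) p) (hX : ContDiff ℝ (⊤ : ℕ∞) X) :
    ContDiff ℝ (⊤ : ℕ∞) (elastica p X D δ a) := by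
  rw [contDiff_euclidean]
  intro i
  fin_cases i <;> simp only [elastica] <;> simp <;> fun_prop

lemma integral_signedCurvature_elastica_sq (hp : ∀ s, HasDerivAt p (angularSpeed (p s)) s)
    (hX : ∀ s, HasDerivAt X (sin (p s) ^ 2) s) (hD : D ≠ 0) (L : ℝ) :
    ∫ s in (0 : ℝ)..L, signedCurvature (elastica p X D δ a) s ^ 2
      = 4 * D * (X (D * L + a) - X a) := by
  rw [signedCurvature_elastica δ a hp hX hD]
  have hpc : Continuous p := continuous_iff_continuousAt.2 fun s => (hp s).continuousAt
  rw [intervalIntegral.integral_eq_sub_of_hasDerivAt (f := fun s => 4 * D * X (D * s + a))]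
  · simp; ring
  · intro s _
    refine ((hasDerivAt_comp_affine (D := D) a hX s).const_mul (4 * D)).congr_deriv ?_
    ring
  · apply Continuous.intervalIntegrable
    fun_prop

end elastica

lemma sub_le_of_hasDerivAt {G : ℝ → ℝ}
    (hG : ∀ q, HasDerivAt G (sin q ^ 2 / angularSpeed q) q) {q r : ℝ} (hqr : q ≤ r) :
    (r - q) / 4 - 1 / 2 ≤ G r - G q := by
  have hd : ∀ x, HasDerivAt (fun x => G x - (x - sin x * cos x) / 4)
      (sin x ^ 2 / angularSpeed x - sin x ^ 2 / 2) x := fun x => by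
    refine ((hG x).sub (((hasDerivAt_id x).sub
      ((hasDerivAt_sin x).mul (hasDerivAt_cos x))).div_const 4)).congr_deriv ?_
    linear_combination (1 / 4 : ℝ) * sin_sq_add_cos_sq x
  have hm : Monotone fun x => G x - (x - sin x * cos x) / 4 := by
    refine monotone_of_deriv_nonneg (fun x => (hd x).differentiableAt) fun x => ?_
    rw [(hd x).deriv, sub_nonneg]
    exact div_le_div_of_nonneg_left (sq_nonneg _) (angularSpeed_pos x) (angularSpeed_le_two x)
  have h := hm hqr
  simp only at h
  have key : ∀ x : ℝ, |sin x * cos x| ≤ 1 := fun x => by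
    rw [abs_mul]
    exact mul_le_one₀ (abs_sin_le_one x) (abs_nonneg _) (abs_cos_le_one x)
  have := abs_le.1 (key q)
  have := abs_le.1 (key r)
  linarith

/-- Endpoint data for which the chord makes the angle `θ` with both end tangents, while the
curvature changes sign from one end to the other. -/
lemma exists_endpoint_data {θ : ℝ} (hθ : θ ∈ Ioo 0 (π / 2)) {G : ℝ → ℝ}
    (hG : ∀ q, HasDerivAt G (sin q ^ 2 / angularSpeed q) q) {M : ℝ} (hM : 0 < M) :
    ∃ δ q r : ℝ, q < r ∧ M ≤ G r - G q ∧ 0 < cos δ ∧ 0 < sin q ∧ sin r < 0 ∧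
      sin δ * (G r - G q) = cos δ * (sin q - sin r) ∧
      sin q ^ 2 = cos (δ + θ) ∧ -(cos q * angularSpeed q) = sin (δ + θ) ∧
      sin r ^ 2 = cos (δ - θ) ∧ -(cos r * angularSpeed r) = sin (δ - θ) := by
  obtain ⟨hθ0, hθ1⟩ := hθ
  obtain ⟨d, hd0, hdθ, hdθ'⟩ : ∃ d, 0 < d ∧ d < θ ∧ d + θ < π / 2 := by
    obtain ⟨d, h0, h1⟩ := exists_between (lt_min hθ0 (sub_pos.2 hθ1))
    exact ⟨d, h0, h1.trans_le (min_le_left _ _), by linarith [h1.trans_le (min_le_right _ _)]⟩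
  have hsd : 0 < sin d := sin_pos_of_pos_of_lt_pi hd0 (by linarith)
  obtain ⟨n, hn⟩ := exists_nat_gt (4 * (M + 2 / sin d) + 2 + 2 * π)
  have hGc : Continuous G := continuous_iff_continuousAt.2 fun s => (hG s).continuousAt
  let u : ℝ → ℝ := fun δ => √(cos (δ + θ))
  let v : ℝ → ℝ := fun δ => √(cos (δ - θ))
  let q : ℝ → ℝ := fun δ => π - arcsin (u δ)
  let r : ℝ → ℝ := fun δ => -arcsin (v δ) + n * (2 * π)
  have hnπ : (n : ℝ) ≤ n * (2 * π) := by
    nlinarith [pi_gt_three, (Nat.cast_nonneg n : (0 : ℝ) ≤ n)]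
  have h2s : 0 < 2 / sin d := by positivity
  have hqr : ∀ δ, 4 * (M + 2 / sin d) + 2 ≤ r δ - q δ := fun δ => by
    simp only [q, r]
    linarith [arcsin_le_pi_div_two (v δ), neg_pi_div_two_le_arcsin (u δ)]
  have hqr' : ∀ δ, q δ < r δ := fun δ => by linarith [hqr δ]
  have hgap : ∀ δ, M + 2 / sin d ≤ G (r δ) - G (q δ) := fun δ => by
    linarith [hqr δ, sub_le_of_hasDerivAt hG (hqr' δ).le]
  have hu1 : ∀ δ, u δ ≤ 1 := fun δ => Real.sqrt_le_one.2 (cos_le_one _)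
  have hv1 : ∀ δ, v δ ≤ 1 := fun δ => Real.sqrt_le_one.2 (cos_le_one _)
  have hu0 : ∀ δ, 0 ≤ u δ := fun δ => Real.sqrt_nonneg _
  have hv0 : ∀ δ, 0 ≤ v δ := fun δ => Real.sqrt_nonneg _
  have hsq : ∀ δ, sin (q δ) = u δ := fun δ => by
    rw [sin_pi_sub, sin_arcsin (by linarith [hu0 δ]) (hu1 δ)]
  have hsr : ∀ δ, sin (r δ) = -v δ := fun δ => by
    rw [sin_add_nat_mul_two_pi, sin_neg, sin_arcsin (by linarith [hv0 δ]) (hv1 δ)]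
  have hcq : ∀ δ, cos (q δ) = -√(1 - u δ ^ 2) := fun δ => by
    rw [cos_pi_sub, cos_arcsin]
  have hcr : ∀ δ, cos (r δ) = √(1 - v δ ^ 2) := fun δ => by
    rw [cos_add_nat_mul_two_pi, cos_neg, cos_arcsin]
  let h : ℝ → ℝ := fun δ => sin δ * (G (r δ) - G (q δ)) - cos δ * (u δ + v δ)
  have hcont : Continuous h := by
    have := continuous_arcsin
    simp only [h, r, q, u, v]
    fun_prop
  have hneg : h 0 ≤ 0 := by
    simp only [h, sin_zero, cos_zero]
    linarith [hu0 0, hv0 0]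
  have hpos : 0 ≤ h d := by
    have h1 : sin d * (M + 2 / sin d) ≤ sin d * (G (r d) - G (q d)) :=
      mul_le_mul_of_nonneg_left (hgap d) hsd.le
    have h2 : sin d * (M + 2 / sin d) = sin d * M + 2 := by field_simp
    have h3 : cos d * (u d + v d) ≤ 1 * 2 :=
      mul_le_mul (cos_le_one d) (by linarith [hu1 d, hv1 d]) (by linarith [hu0 d, hv0 d]) one_pos.le
    have h4 := mul_pos hsd hM
    simp only [h]
    linarith
  obtain ⟨δ, ⟨hδ0, hδd⟩, hδ⟩ := intermediate_value_Icc hd0.le hcont.continuousOn ⟨hneg, hpos⟩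
  have hcosu : 0 < cos (δ + θ) := cos_pos_of_mem_Ioo ⟨by linarith, by linarith⟩
  have hcosv : 0 < cos (δ - θ) := cos_pos_of_mem_Ioo ⟨by linarith, by linarith⟩
  have hu2 : u δ ^ 2 = cos (δ + θ) := Real.sq_sqrt hcosu.le
  have hv2 : v δ ^ 2 = cos (δ - θ) := Real.sq_sqrt hcosv.le
  have hprod : ∀ x : ℝ, √(1 - cos x) * √(1 + cos x) = |sin x| := fun x => by
    rw [← Real.sqrt_mul (by linarith [cos_le_one x]), ← Real.sqrt_sq_eq_abs]
    congr 1
    linear_combination -sin_sq_add_cos_sq x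
  have hsu : 0 ≤ sin (δ + θ) := sin_nonneg_of_nonneg_of_le_pi (by linarith) (by linarith)
  have hsv : sin (δ - θ) ≤ 0 := sin_nonpos_of_nonpos_of_neg_pi_le (by linarith) (by linarith)
  refine ⟨δ, q δ, r δ, hqr' δ, by linarith [hgap δ],
    cos_pos_of_mem_Ioo ⟨by linarith, by linarith⟩, ?_, ?_, ?_, ?_, ?_, ?_, ?_⟩
  · rw [hsq]; exact Real.sqrt_pos.2 hcosu
  · rw [hsr, neg_lt_zero]; exact Real.sqrt_pos.2 hcosv
  · rw [hsq, hsr]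
    simp only [h] at hδ
    linarith
  · rw [hsq, hu2]
  · have := hprod (δ + θ)
    rw [abs_of_nonneg hsu] at this
    rw [hcq, angularSpeed, hsq, hu2, neg_mul, neg_neg, this]
  · rw [hsr, neg_sq, hv2]
  · have := hprod (δ - θ)
    rw [abs_of_nonpos hsv] at this
    rw [hcr, angularSpeed, hsr, neg_sq, hv2, this, neg_neg]

end WillmoreCurve

/-- For `θ ∈ (0,π/2)`, `A = (0,0)`, `B = (1,0)` and any `E > 0`, the Dirichlet problem
with boundary directions `(cos θ, sin θ)` and `(cos θ, −sin θ)` admits a Willmore curve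
solution that is NOT axially symmetric and whose Willmore energy exceeds `E`; in
particular it has infinitely many axially non-symmetric solutions with energies tending
to `+∞`. -/
theorem dirichlet_problem_axially_nonsymmetric_solutions
    (θ : ℝ) (hθ : θ ∈ Set.Ioo 0 (Real.pi / 2)) (E : ℝ) (hE : 0 < E) :
    ∃ (L : ℝ) (γ : ℝ → EuclideanSpace ℝ (Fin 2)),
      0 < L ∧ ContDiff ℝ (⊤ : ℕ∞) γ ∧
      (∀ s ∈ Set.Icc (0 : ℝ) L, ‖deriv γ s‖ = 1) ∧
      (∀ s ∈ Set.Icc (0 : ℝ) L,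
        -(2 * deriv (deriv (signedCurvature γ)) s) = (signedCurvature γ s) ^ 3) ∧
      (γ 0 0 = 0 ∧ γ 0 1 = 0) ∧ (γ L 0 = 1 ∧ γ L 1 = 0) ∧
      (deriv γ 0 0 = Real.cos θ ∧ deriv γ 0 1 = Real.sin θ) ∧
      (deriv γ L 0 = Real.cos θ ∧ deriv γ L 1 = -Real.sin θ) ∧
      (¬ ∃ (P : EuclideanSpace ℝ (Fin 2) ≃ₗᵢ[ℝ] EuclideanSpace ℝ (Fin 2))
         (c : EuclideanSpace ℝ (Fin 2)),
          LinearMap.det (P.toLinearEquiv :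
            EuclideanSpace ℝ (Fin 2) →ₗ[ℝ] EuclideanSpace ℝ (Fin 2)) = -1 ∧
          ∀ s ∈ Set.Icc (0 : ℝ) L, γ (L - s) + P (γ s) = c) ∧
      (1 / 2) * (∫ s in (0 : ℝ)..L, (signedCurvature γ s) ^ 2) > E := by
  open WillmoreCurve in
  obtain ⟨p, hp, hsurj⟩ := exists_amplitude
  obtain ⟨G, hG⟩ := exists_hasDerivAt_of_continuous
    (f := fun q => Real.sin q ^ 2 / angularSpeed q)
    ((Real.continuous_sin.pow 2).div₀ contDiff_angularSpeed.continuous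
      fun q => (angularSpeed_pos q).ne')
  obtain ⟨δ, q, r, hqr, hM, hcδ, hsq, hsr, hchord, hq1, hq2, hr1, hr2⟩ :=
    exists_endpoint_data hθ hG (M := 1 + E) (by linarith)
  obtain ⟨a, rfl⟩ := hsurj q
  obtain ⟨b, rfl⟩ := hsurj r
  let X := fun s => G (p s)
  have hX : ∀ s, HasDerivAt X (Real.sin (p s) ^ 2) s := fun s => by
    refine ((hG (p s)).comp s (hp s)).congr_deriv ?_
    have := (angularSpeed_pos (p s)).ne'
    field_simp
  have hpC := contDiff_of_hasDerivAt_comp contDiff_angularSpeed hp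
  have hXC : ContDiff ℝ (⊤ : ℕ∞) X := by
    refine contDiff_infty_iff_deriv.2 ⟨fun s => (hX s).differentiableAt, ?_⟩
    rw [funext fun s => (hX s).deriv]
    fun_prop
  have hpm : StrictMono p := strictMono_of_deriv_pos fun s => by
    rw [(hp s).deriv]; exact angularSpeed_pos _
  have hab : a < b := hpm.lt_iff_lt.1 hqr
  have hM' : 1 + E ≤ X b - X a := hM
  obtain ⟨D, hD1, hDc, hDs⟩ : ∃ D, 1 + E ≤ D ∧ X b - X a = D * Real.cos δ ∧
      Real.sin (p a) - Real.sin (p b) = D * Real.sin δ := by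
    refine ⟨(X b - X a) / Real.cos δ, ?_, ?_, ?_⟩
    · rw [le_div_iff₀ hcδ]
      nlinarith [Real.cos_le_one δ]
    · field_simp
    · have : Real.sin δ * (X b - X a) = _ := hchord
      field_simp
      linarith
  have hD0 : 0 < D := by linarith
  have hL : 0 < (b - a) / D := div_pos (sub_pos.2 hab) hD0
  have hend : D * ((b - a) / D) + a = b := by field_simp; ring
  have hcs := Real.sin_sq_add_cos_sq δ
  have hC := contDiff_elastica (D := D) δ a hpC hXC
  have hq2' := neg_eq_iff_eq_neg.1 hq2
  have hr2' := neg_eq_iff_eq_neg.1 hr2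
  refine ⟨(b - a) / D, elastica p X D δ a, hL, hC,
    fun s _ => norm_deriv_elastica δ a hp hX hD0.ne' s,
    fun s _ => willmore_elastica δ a hp hX hD0.ne' s, ?_, ?_, ?_, ?_, ?_, ?_⟩
  · simp [elastica]
  · simp only [elastica, hend, hDc]
    have hDs' : Real.sin (p b) - Real.sin (p a) = -(D * Real.sin δ) := by linarith
    simp only [hDs']
    constructor
    · simp
      field_simp
      linarith
    · simp
      left
      ring
  · simp only [deriv_elastica δ a hp hX hD0.ne', mul_zero, zero_add, hq1, hq2']
    simp [Real.cos_add, Real.sin_add]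
    constructor
    · linear_combination Real.cos θ * hcs
    · linear_combination Real.sin θ * hcs
  · simp only [deriv_elastica δ a hp hX hD0.ne', hend, hr1, hr2']
    simp [Real.cos_sub, Real.sin_sub]
    constructor
    · linear_combination Real.cos θ * hcs
    · linear_combination -Real.sin θ * hcs
  · rintro ⟨P, c, hP, hsymm⟩
    have h := signedCurvature_endpoints_eq_of_axiallySymmetric hC hL P c hP hsymm
    simp only [signedCurvature_elastica δ a hp hX hD0.ne', hend, mul_zero, zero_add] at h
    have := mul_left_cancel₀ (by positivity) h
    linarith
  · rw [integral_signedCurvature_elastica_sq δ a hp hX hD0.ne', hend]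
    nlinarith
end

section
/- Let L > 0 and let γ : [0,L] → ℝ² be a smooth unit-speed curve whose curvature κ(s) := det(γ'(s), γ''(s)) satisfies −2κ'' = κ³ on [0,L], and suppose a⁴ := κ'(0)² + κ(0)⁴/4 > 0. Setting α := (1/(2a²))∫₀ᴸ κ(s)² ds and β := (κ(0) − κ(L))/a², one has ‖γ(L) − γ(0)‖² = α² + β². -/
/-- A real function with vanishing derivative on `[0,L]` takes the same value everywhere
as at `0`. -/
lemma eq_zero_value_of_hasDerivAt_zero {L : ℝ} {f : ℝ → ℝ}
    (hf : ∀ s ∈ Set.Icc (0 : ℝ) L, HasDerivAt f 0 s) :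
    ∀ s ∈ Set.Icc (0 : ℝ) L, f s = f 0 :=
  constant_of_has_deriv_right_zero
    (fun s hs => (hf s hs).continuousAt.continuousWithinAt)
    (fun s hs => (hf s (Set.Ico_subset_Icc_self hs)).hasDerivWithinAt)

/-- The velocity of a unit-speed curve on `[0,L]` is orthogonal to its acceleration. -/
lemma velocity_orthogonal_acceleration {L : ℝ} (hL : 0 < L) {u v u' v' : ℝ → ℝ}
    (hu : ∀ s, HasDerivAt u (u' s) s) (hv : ∀ s, HasDerivAt v (v' s) s)
    (hunit : ∀ s ∈ Set.Icc (0 : ℝ) L, u s ^ 2 + v s ^ 2 = 1) :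
    ∀ s ∈ Set.Icc (0 : ℝ) L, u s * u' s + v s * v' s = 0 := by
  intro s hs
  have h1 := (((hu s).pow 2).add ((hv s).pow 2)).hasDerivWithinAt (s := Set.Icc (0 : ℝ) L)
  have h2 : HasDerivWithinAt (u ^ 2 + v ^ 2) 0 (Set.Icc (0 : ℝ) L) s :=
    (hasDerivWithinAt_const s (Set.Icc (0 : ℝ) L) (1 : ℝ)).congr
      (fun t ht => by simpa using hunit t ht) (by simpa using hunit s hs)
  have h := (uniqueDiffOn_Icc hL s hs).eq_deriv _ h1 h2
  norm_num at h
  linarith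

/-- Chord length formula in coordinates: `(u, v)` is the velocity of the curve `(x, y)`, and
`(κ² u - 2κ' v, κ² v + 2κ' u)` is the conserved vector. -/
lemma chord_length_formula_coordinates {L : ℝ} (hL : 0 < L)
    {x y u v u' v' κ κ' κ'' : ℝ → ℝ}
    (hx : ∀ s, HasDerivAt x (u s) s) (hy : ∀ s, HasDerivAt y (v s) s)
    (hu : ∀ s, HasDerivAt u (u' s) s) (hv : ∀ s, HasDerivAt v (v' s) s)
    (hk : ∀ s, HasDerivAt κ (κ' s) s) (hk' : ∀ s, HasDerivAt κ' (κ'' s) s)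
    (hunit : ∀ s ∈ Set.Icc (0 : ℝ) L, u s ^ 2 + v s ^ 2 = 1)
    (hκ : ∀ s, κ s = u s * v' s - v s * u' s)
    (hode : ∀ s ∈ Set.Icc (0 : ℝ) L, -(2 * κ'' s) = κ s ^ 3) :
    4 * (κ' 0 ^ 2 + κ 0 ^ 4 / 4) * ((x L - x 0) ^ 2 + (y L - y 0) ^ 2) =
      (∫ s in (0 : ℝ)..L, κ s ^ 2) ^ 2 + 4 * (κ 0 - κ L) ^ 2 := by
  have horth := velocity_orthogonal_acceleration hL hu hv hunit
  have hu' : ∀ s ∈ Set.Icc (0 : ℝ) L, u' s = -κ s * v s := fun s hs => by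
    rw [hκ]; linear_combination (-u' s) * hunit s hs + u s * horth s hs
  have hv' : ∀ s ∈ Set.Icc (0 : ℝ) L, v' s = κ s * u s := fun s hs => by
    rw [hκ]; linear_combination (-v' s) * hunit s hs + v s * horth s hs
  have h0 : (0 : ℝ) ∈ Set.Icc (0 : ℝ) L := ⟨le_rfl, hL.le⟩
  have hLm : L ∈ Set.Icc (0 : ℝ) L := ⟨hL.le, le_rfl⟩
  have hJ := eq_zero_value_of_hasDerivAt_zero (L := L)
    (f := fun s => κ s ^ 2 * u s - 2 * (κ' s * v s)) fun s hs => by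
      refine ((((hk s).fun_pow 2).fun_mul (hu s)).fun_sub
        (((hk' s).fun_mul (hv s)).const_mul 2)).congr_deriv ?_
      rw [hu' s hs, hv' s hs]
      push_cast
      linear_combination v s * hode s hs
  have hK := eq_zero_value_of_hasDerivAt_zero (L := L)
    (f := fun s => κ s ^ 2 * v s + 2 * (κ' s * u s)) fun s hs => by
      refine ((((hk s).fun_pow 2).fun_mul (hv s)).fun_add
        (((hk' s).fun_mul (hu s)).const_mul 2)).congr_deriv ?_
      rw [hu' s hs, hv' s hs]
      push_cast
      linear_combination (-u s) * hode s hs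
  set p := κ 0 ^ 2 * u 0 - 2 * (κ' 0 * v 0) with hp
  set q := κ 0 ^ 2 * v 0 + 2 * (κ' 0 * u 0) with hq
  have hκc : Continuous fun s => κ s ^ 2 :=
    (continuous_iff_continuousAt.2 fun s => (hk s).continuousAt).pow 2
  have hdot := eq_zero_value_of_hasDerivAt_zero (L := L)
    (f := fun s => p * x s + q * y s - ∫ t in (0 : ℝ)..s, κ t ^ 2) (fun s hs => by
      refine ((((hx s).const_mul p).fun_add ((hy s).const_mul q)).fun_sub
        (intervalIntegral.integral_hasDerivAt_right (hκc.intervalIntegrable _ _)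
          hκc.stronglyMeasurable.stronglyMeasurableAtFilter hκc.continuousAt)).congr_deriv ?_
      rw [← hJ s hs, ← hK s hs]
      linear_combination κ s ^ 2 * hunit s hs) L hLm
  have hcross := eq_zero_value_of_hasDerivAt_zero (L := L)
    (f := fun s => p * y s - q * x s + 2 * κ s) (fun s hs => by
      refine ((((hy s).const_mul p).fun_sub ((hx s).const_mul q)).fun_add
        ((hk s).const_mul 2)).congr_deriv ?_
      rw [← hJ s hs, ← hK s hs]
      linear_combination (-2 * κ' s) * hunit s hs) L hLm
  simp only [intervalIntegral.integral_same] at hdot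
  have hnorm : 4 * (κ' 0 ^ 2 + κ 0 ^ 4 / 4) = p ^ 2 + q ^ 2 := by
    rw [hp, hq]
    linear_combination (-(κ 0 ^ 4 + 4 * κ' 0 ^ 2)) * hunit 0 h0
  have h1 : ∫ s in (0 : ℝ)..L, κ s ^ 2 = p * (x L - x 0) + q * (y L - y 0) := by
    linear_combination -hdot
  have h2 : 2 * (κ 0 - κ L) = p * (y L - y 0) - q * (x L - x 0) := by
    linear_combination -hcross
  rw [hnorm, h1]
  linear_combination
    (-(2 * (κ 0 - κ L)) - (p * (y L - y 0) - q * (x L - x 0))) * h2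

/-- The coordinates of a differentiable planar curve are differentiable, with derivatives the
coordinates of the derivative. -/
lemma hasDerivAt_coordinate {γ : ℝ → EuclideanSpace ℝ (Fin 2)} (hγ : Differentiable ℝ γ)
    (i : Fin 2) (s : ℝ) : HasDerivAt (fun t => γ t i) (deriv γ s i) s :=
  (EuclideanSpace.proj (𝕜 := ℝ) i).hasFDerivAt.comp_hasDerivAt s (hγ s).hasDerivAt

/-- Chord length formula for planar Willmore curves: if `γ` is a smooth unit-speed curve
on `[0,L]` whose curvature `κ` satisfies `−2κ'' = κ³` and `a⁴ := κ'(0)² + κ(0)⁴/4 > 0`,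
then `‖γ(L) − γ(0)‖² = α² + β²` where `α := (1/(2a²))∫₀ᴸ κ²` and
`β := (κ(0) − κ(L))/a²`. -/
theorem willmore_chord_length_formula
    (L : ℝ) (hL : 0 < L) (γ : ℝ → EuclideanSpace ℝ (Fin 2))
    (hγ : ContDiff ℝ (⊤ : ℕ∞) γ)
    (hunit : ∀ s ∈ Set.Icc (0 : ℝ) L, ‖deriv γ s‖ = 1)
    (κ : ℝ → ℝ) (hκ : ∀ s, κ s = signedCurvature γ s)
    (hode : ∀ s ∈ Set.Icc (0 : ℝ) L, -(2 * deriv (deriv κ) s) = (κ s) ^ 3)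
    (a : ℝ) (ha : a ^ 4 = deriv κ 0 ^ 2 + κ 0 ^ 4 / 4) (hapos : 0 < a ^ 4)
    (α β : ℝ)
    (hα : α = (1 / (2 * a ^ 2)) * ∫ s in (0 : ℝ)..L, κ s ^ 2)
    (hβ : β = (κ 0 - κ L) / a ^ 2) :
    ‖γ L - γ 0‖ ^ 2 = α ^ 2 + β ^ 2 := by
  have hγ1 : ContDiff ℝ (⊤ : ℕ∞) (deriv γ) := (contDiff_infty_iff_deriv.1 hγ).2
  have hγ2 : ContDiff ℝ (⊤ : ℕ∞) (deriv (deriv γ)) := (contDiff_infty_iff_deriv.1 hγ1).2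
  have hγ1c : ∀ i, ContDiff ℝ (⊤ : ℕ∞) fun s => deriv γ s i := contDiff_euclidean.1 hγ1
  have hγ2c : ∀ i, ContDiff ℝ (⊤ : ℕ∞) fun s => deriv (deriv γ) s i := contDiff_euclidean.1 hγ2
  have hκs : ContDiff ℝ (⊤ : ℕ∞) κ := by
    rw [funext hκ]
    exact ((hγ1c 0).mul (hγ2c 1)).sub ((hγ1c 1).mul (hγ2c 0))
  have hκ1 := contDiff_infty_iff_deriv.1 hκs
  have hκ2 := contDiff_infty_iff_deriv.1 hκ1.2
  have hd := (contDiff_infty_iff_deriv.1 hγ).1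
  have hd1 := (contDiff_infty_iff_deriv.1 hγ1).1
  have hmain := chord_length_formula_coordinates hL
    (hasDerivAt_coordinate hd 0) (hasDerivAt_coordinate hd 1)
    (hasDerivAt_coordinate hd1 0) (hasDerivAt_coordinate hd1 1)
    (fun s => (hκ1.1 s).hasDerivAt) (fun s => (hκ2.1 s).hasDerivAt)
    (fun s hs => by
      have h := EuclideanSpace.real_norm_sq_eq (deriv γ s)
      rw [hunit s hs, Fin.sum_univ_two] at h
      linarith)
    hκ hode
  have ha0 : a ≠ 0 := by
    rintro rfl
    norm_num at hapos
  rw [← ha] at hmain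
  rw [EuclideanSpace.real_norm_sq_eq, Fin.sum_univ_two, hα, hβ]
  simp only [PiLp.sub_apply]
  field_simp
  linear_combination hmain
end
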